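/- arXiv:1209.6243 — 2 statements merged into one kernel-verified Lean document; each statement's English description precedes it below -/
import Mathlib

section
/- Let K be a field, R a parameter K-algebra, C a commutative K-algebra, A a Poisson R-deformation of C, and τ : C → C' a principal localization. Then there exist a Poisson R-deformation A' of C' and a homomorphism of Poisson R-algebras g : A → A' (an R-algebra homomorphism respecting the Poisson brackets) lifting τ, i.e., compatible with the augmentations A → C and A' → C'. -/
universe u

/-- An `R`-bilinear Poisson bracket on a commutative `R`-algebra `A`: a bracket which is
`R`-linear in each argument (linearity in the second argument follows from antisymmetry),
antisymmetric, satisfies the Jacobi identity, and is a derivation in each argument. -/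
structure PoissonBracket (R : Type u) (A : Type u) [CommRing R] [CommRing A]
    [Algebra R A] where
  br : A → A → A
  add_left : ∀ x y z : A, br (x + y) z = br x z + br y z
  smul_left : ∀ (r : R) (x z : A), br (r • x) z = r • br x z
  antisymm : ∀ x y : A, br x y = - br y x
  jacobi : ∀ x y z : A, br x (br y z) + br y (br z x) + br z (br x y) = 0
  leibniz : ∀ x y z : A, br x (y * z) = br x y * z + y * br x z

/-- A function on a localization that satisfies the Leibniz rule and vanishes on the base ring
is zero. -/
theorem IsLocalization.eq_zero_of_leibniz {A B M : Type*} [CommRing A] [CommRing B]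
    [Algebra A B] (S : Submonoid A) [IsLocalization S B] [AddCommGroup M] [Module B M]
    (f : B → M) (hf : ∀ x y, f (x * y) = x • f y + y • f x)
    (h : ∀ a, f (algebraMap A B a) = 0) (b : B) : f b = 0 := by
  obtain ⟨⟨x, t⟩, hx⟩ := IsLocalization.surj S b
  have h1 := hf b (algebraMap A B t)
  rw [hx, h, h, smul_zero, zero_add] at h1
  exact ((IsLocalization.map_units B t).smul_eq_zero).1 h1.symm

/-- Derivations extend along localizations. -/
theorem Derivation.exists_extend_localization {R A B M : Type u} [CommRing R] [CommRing A]
    [CommRing B] [Algebra R A] [Algebra R B] [Algebra A B] [IsScalarTower R A B]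
    (S : Submonoid A) [IsLocalization S B] [AddCommGroup M] [Module R M] [Module A M] [Module B M]
    [IsScalarTower R A M] [IsScalarTower A B M] [IsScalarTower R B M] (D : Derivation R A M) :
    ∃ D' : Derivation R B M, ∀ a, D' (algebraMap A B a) = D a := by
  have := Algebra.FormallyEtale.of_isLocalization (Rₘ := B) S
  have hb := KaehlerDifferential.isBaseChange_of_formallyEtale R A B
  refine ⟨(hb.lift D.liftKaehlerDifferential).compDer (KaehlerDifferential.D R B), fun a ↦ ?_⟩
  have h := hb.lift_eq D.liftKaehlerDifferential (KaehlerDifferential.D R A a)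
  simpa using h

namespace PoissonBracket

section Basic

variable {R A : Type u} [CommRing R] [CommRing A] [Algebra R A] (P : PoissonBracket R A)

theorem add_right (x y z : A) : P.br x (y + z) = P.br x y + P.br x z := by
  rw [P.antisymm, P.add_left, P.antisymm y, P.antisymm z]; ring

theorem smul_right (r : R) (x z : A) : P.br x (r • z) = r • P.br x z := by
  rw [P.antisymm, P.smul_left, P.antisymm z, smul_neg, neg_neg]

theorem leibniz_left (x y z : A) : P.br (y * z) x = P.br y x * z + y * P.br z x := by
  rw [P.antisymm, P.leibniz, P.antisymm x y, P.antisymm x z]; ring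

/-- The adjoint derivation `br x`. -/
def ad (x : A) : Derivation R A A :=
  Derivation.mk'
    { toFun := P.br x
      map_add' := P.add_right x
      map_smul' := fun r z ↦ P.smul_right r x z }
    fun y z ↦ by
      change P.br x (y * z) = y * P.br x z + z * P.br x y
      rw [P.leibniz]; ring

@[simp]
theorem ad_apply (x y : A) : P.ad x y = P.br x y := rfl

end Basic

/-- Poisson brackets extend along localizations. -/
theorem exists_extend_localization {R A B : Type u} [CommRing R] [CommRing A]
    [CommRing B] [Algebra R A] [Algebra R B] [Algebra A B] [IsScalarTower R A B]
    (S : Submonoid A) [IsLocalization S B] (P : PoissonBracket R A) :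
    ∃ Q : PoissonBracket R B,
      ∀ x y, Q.br (algebraMap A B x) (algebraMap A B y) = algebraMap A B (P.br x y) := by
  have h1 (x : A) := Derivation.exists_extend_localization (B := B) S
    ((Algebra.linearMap A B).compDer (P.ad x))
  choose E hE using h1
  replace hE (x y : A) : E x (algebraMap A B y) = algebraMap A B (P.br x y) := hE x y
  have ext0 (D₁ D₂ : Derivation R B B)
      (h : ∀ a, D₁ (algebraMap A B a) = D₂ (algebraMap A B a)) : D₁ = D₂ := by
    ext b
    rw [← sub_eq_zero]
    refine IsLocalization.eq_zero_of_leibniz S (fun b ↦ D₁ b - D₂ b) (fun x y ↦ ?_) (fun a ↦ ?_) b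
    · simp only [Derivation.leibniz, smul_eq_mul]; ring
    · simp [h]
  let F : Derivation R A (Derivation R B B) := Derivation.mk'
    { toFun := E
      map_add' := fun x y ↦ ext0 _ _ fun a ↦ by simp [hE, P.add_left]
      map_smul' := fun r x ↦ ext0 _ _ fun a ↦ by
        rw [Derivation.smul_apply, hE, hE, P.smul_left]
        exact map_smul (IsScalarTower.toAlgHom R A B) r _ }
    fun x y ↦ ext0 _ _ fun a ↦ by
      simp [hE, P.leibniz_left, Algebra.smul_def]; ring
  obtain ⟨G, hG⟩ := Derivation.exists_extend_localization (B := B) S F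
  have hGA (x y : A) : G (algebraMap A B x) (algebraMap A B y) = algebraMap A B (P.br x y) := by
    rw [hG]; exact hE x y
  have hl (x y z : B) : G (x * y) z = x * G y z + y * G x z := by simp
  have hr (x y z : B) : G x (y * z) = y * G x z + z * G x y := by simp
  have anti (x y : B) : G x y = - G y x := by
    rw [← sub_eq_zero, sub_neg_eq_add]
    refine IsLocalization.eq_zero_of_leibniz S (fun x ↦ G x y + G y x) (fun u v ↦ ?_) (fun a ↦ ?_) x
    · simp only [hl, hr, smul_eq_mul]; ring
    refine IsLocalization.eq_zero_of_leibniz S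
      (fun y ↦ G (algebraMap A B a) y + G y (algebraMap A B a)) (fun u v ↦ ?_) (fun b ↦ ?_) y
    · simp only [hl, hr, smul_eq_mul]; ring
    · simp only [hGA, ← map_add]; rw [P.antisymm]; simp
  have jac_leib (x y u v : B) :
      G x (G y (u * v)) + G y (G (u * v) x) + G (u * v) (G x y) =
        u • (G x (G y v) + G y (G v x) + G v (G x y)) +
        v • (G x (G y u) + G y (G u x) + G u (G x y)) := by
    simp only [hl, hr, map_add, smul_eq_mul]
    rw [anti v x, anti u x]; ring
  have jac (x y z : B) : G x (G y z) + G y (G z x) + G z (G x y) = 0 := by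
    refine IsLocalization.eq_zero_of_leibniz S
      (fun z ↦ G x (G y z) + G y (G z x) + G z (G x y)) (jac_leib x y) (fun c ↦ ?_) z
    rw [add_assoc, add_comm]
    refine IsLocalization.eq_zero_of_leibniz S
      (fun y ↦ G y (G (algebraMap A B c) x) + G (algebraMap A B c) (G x y) +
        G x (G y (algebraMap A B c))) (fun u v ↦ ?_) (fun b ↦ ?_) y
    · have := jac_leib (algebraMap A B c) x u v
      simp only [smul_eq_mul] at this ⊢
      linear_combination this
    rw [add_assoc, add_comm]
    refine IsLocalization.eq_zero_of_leibniz S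
      (fun x ↦ G (algebraMap A B c) (G x (algebraMap A B b)) +
        G x (G (algebraMap A B b) (algebraMap A B c)) +
        G (algebraMap A B b) (G (algebraMap A B c) x)) (fun u v ↦ ?_) (fun a ↦ ?_) x
    · have := jac_leib (algebraMap A B b) (algebraMap A B c) u v
      simp only [smul_eq_mul] at this ⊢
      linear_combination this
    · simp only [hGA, ← map_add]
      rw [P.jacobi, map_zero]
  exact ⟨{
    br := fun x y ↦ G x y
    add_left := fun x y z ↦ by simp
    smul_left := fun r x z ↦ by simp
    antisymm := anti
    jacobi := jac
    leibniz := fun x y z ↦ by rw [hr]; ring }, hGA⟩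

end PoissonBracket

theorem LinearMap.map_mem_smul_top {R P Q : Type*} [CommRing R] [AddCommGroup P]
    [AddCommGroup Q] [Module R P] [Module R Q] (u : P →ₗ[R] Q) (I : Ideal R) {z : P}
    (hz : z ∈ (I • ⊤ : Submodule R P)) : u z ∈ (I • ⊤ : Submodule R Q) := by
  have := Submodule.mem_map_of_mem (f := u) hz
  rw [Submodule.map_smul''] at this
  exact Submodule.smul_mono le_rfl le_top this

open TensorProduct in
/-- The Artin-Rees lemma for the base change of a linear map to a flat module. -/
theorem Module.Flat.exists_artinRees_lTensor {R M F G : Type*} [CommRing R] [IsNoetherianRing R]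
    [AddCommGroup M] [Module R M] [Module.Flat R M] [AddCommGroup F] [Module R F]
    [AddCommGroup G] [Module R G] [Module.Finite R G] (I : Ideal R) (h : F →ₗ[R] G) :
    ∃ c : ℕ, ∀ (n : ℕ) (z : M ⊗[R] F),
      h.lTensor M z ∈ (I ^ (n + c) • ⊤ : Submodule R (M ⊗[R] G)) →
      ∃ w ∈ (I ^ n • ⊤ : Submodule R (M ⊗[R] F)), h.lTensor M w = h.lTensor M z := by
  obtain ⟨c, hc⟩ := Ideal.exists_pow_inf_eq_pow_smul I (LinearMap.range h)
  refine ⟨c, fun n z hz ↦ ?_⟩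
  let q := (I ^ (n + c) • ⊤ : Submodule R G).mkQ
  let N := LinearMap.ker (q ∘ₗ h)
  have hN (x : N) : ∃ v ∈ (I ^ n • ⊤ : Submodule R F), h v = h x := by
    have hx : h x ∈ (I ^ (n + c) • ⊤ : Submodule R G) := by
      have : q (h x) = 0 := x.2
      rwa [Submodule.mkQ_apply, Submodule.Quotient.mk_eq_zero] at this
    have h2 : h x ∈ I ^ n • (I ^ c • ⊤ ⊓ LinearMap.range h) := by
      have := hc (n + c) (by lia)
      rw [Nat.add_sub_cancel] at this
      rw [← this]
      exact ⟨hx, x, rfl⟩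
    have h3 : h x ∈ Submodule.map h (I ^ n • ⊤ : Submodule R F) := by
      rw [Submodule.map_smul'', Submodule.map_top]
      exact Submodule.smul_mono le_rfl inf_le_right h2
    exact h3
  have hex : Function.Exact (N.subtype.lTensor M) ((q ∘ₗ h).lTensor M) :=
    Module.Flat.lTensor_exact M (LinearMap.exact_subtype_ker_map _)
  have hz0 : (q ∘ₗ h).lTensor M z = 0 := by
    rw [LinearMap.lTensor_comp_apply]
    have h1 := LinearMap.map_mem_smul_top (q.lTensor M) _ hz
    have h2 : (I ^ (n + c) • ⊤ :
        Submodule R (M ⊗[R] (G ⧸ (I ^ (n + c) • ⊤ : Submodule R G)))) ≤ ⊥ := by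
      rw [Submodule.smul_le]
      intro r hr t _
      induction t with
      | zero => simp
      | add x y hx hy =>
        rw [smul_add]
        exact add_mem (hx Submodule.mem_top) (hy Submodule.mem_top)
      | tmul x y =>
        obtain ⟨y, rfl⟩ := Submodule.mkQ_surjective _ y
        have : (I ^ (n + c) • ⊤ : Submodule R G).mkQ (r • y) = 0 := by
          rw [Submodule.mkQ_apply, Submodule.Quotient.mk_eq_zero]
          exact Submodule.smul_mem_smul hr Submodule.mem_top
        rw [← TensorProduct.tmul_smul, ← map_smul, this, TensorProduct.tmul_zero]
        exact zero_mem _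
    simpa using h2 h1
  obtain ⟨t, rfl⟩ := (hex z).1 hz0
  clear hz hz0
  induction t with
  | zero => exact ⟨0, zero_mem _, by simp⟩
  | add x y hx hy =>
    obtain ⟨v, hv, hv'⟩ := hx
    obtain ⟨w, hw, hw'⟩ := hy
    exact ⟨v + w, add_mem hv hw, by simp only [map_add, hv', hw']⟩
  | tmul m x =>
    obtain ⟨v, hv, hv'⟩ := hN x
    refine ⟨m ⊗ₜ v, ?_, by simp [hv']⟩
    exact LinearMap.map_mem_smul_top (TensorProduct.mk R M F m) _ hv

open TensorProduct in
/-- An adically complete module over a noetherian ring is flat if some flat module is dense in it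
and carries the induced filtration. -/
theorem Module.Flat.of_dense_of_isAdicComplete {R M N : Type*} [CommRing R] [IsNoetherianRing R]
    [AddCommGroup M] [Module R M] [Module.Flat R M] [AddCommGroup N] [Module R N]
    (I : Ideal R) [IsAdicComplete I N] (φ : M →ₗ[R] N)
    (dense : ∀ n x, ∃ y, x - φ y ∈ (I ^ n • ⊤ : Submodule R N))
    (strict : ∀ n y, φ y ∈ (I ^ n • ⊤ : Submodule R N) → y ∈ (I ^ n • ⊤ : Submodule R M)) :
    Module.Flat R N := by
  refine Module.Flat.of_forall_isTrivialRelation fun {l f x} hfx ↦ ?_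
  let g : (Fin l → R) →ₗ[R] R := Fintype.linearCombination R f
  obtain ⟨m, k, hk⟩ := (Submodule.fg_iff_exists_fin_linearMap _ _).1
    (IsNoetherian.noetherian (LinearMap.ker g))
  have hgk : g ∘ₗ k = 0 := by
    ext j
    have : k (Pi.single j 1) ∈ LinearMap.ker g := hk ▸ ⟨_, rfl⟩
    simpa using this
  have hex : Function.Exact (k.lTensor M) (g.lTensor M) :=
    Module.Flat.lTensor_exact M (LinearMap.exact_iff.2 hk.symm)
  let co (p : ℕ) (i : Fin p) : M ⊗[R] (Fin p → R) →ₗ[R] M :=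
    (TensorProduct.rid R M).toLinearMap ∘ₗ (LinearMap.proj i).lTensor M
  obtain ⟨c, hc⟩ := Module.Flat.exists_artinRees_lTensor (M := M) I g
  obtain ⟨d, hd⟩ := Module.Flat.exists_artinRees_lTensor (M := M) I k
  choose X hX using fun n i ↦ dense n (x i)
  let Z (n : ℕ) : M ⊗[R] (Fin l → R) := ∑ i, X n i ⊗ₜ Pi.single i 1
  have co_single (p : ℕ) (v : Fin p → M) (i : Fin p) :
      co p i (∑ j, v j ⊗ₜ Pi.single j 1) = v i := by
    simp [co, Pi.single_apply]
  have co_map (i : Fin l) (z : M ⊗[R] (Fin m → R)) :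
      co l i (k.lTensor M z) = ∑ j, k (Pi.single j 1) i • co m j z := by
    induction z with
    | zero => simp
    | add x y hx hy => simp only [map_add, hx, hy, smul_add, Finset.sum_add_distrib]
    | tmul x v =>
      have : k v i = ∑ j, v j * k (Pi.single j 1) i := by
        conv_lhs => rw [LinearMap.pi_apply_eq_sum_univ k v]
        simp only [smul_eq_mul, Finset.sum_apply, Pi.smul_apply]
        refine Finset.sum_congr rfl fun j _ ↦ ?_
        have : (Pi.single j 1 : Fin m → R) = fun a ↦ if j = a then 1 else 0 := by
          ext a
          simp [Pi.single_apply, eq_comm]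
        rw [this]
      simp only [co, LinearMap.comp_apply, LinearMap.lTensor_tmul, LinearMap.proj_apply, this,
        LinearEquiv.coe_coe, TensorProduct.rid_tmul, Finset.sum_smul]
      simp only [mul_comm (v _), mul_smul]
  have X_cauchy (n : ℕ) (i : Fin l) : X (n + 1) i - X n i ∈ (I ^ n • ⊤ : Submodule R M) := by
    apply strict
    have := sub_mem (hX n i) (Submodule.pow_smul_top_le I _ (Nat.le_succ n) (hX (n + 1) i))
    simpa using this
  have Z_cauchy (n : ℕ) : Z (n + 1) - Z n ∈ (I ^ n • ⊤ : Submodule R _) := by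
    simp only [Z, ← Finset.sum_sub_distrib, ← TensorProduct.sub_tmul]
    exact sum_mem fun i _ ↦
      LinearMap.map_mem_smul_top ((TensorProduct.mk R M (Fin l → R)).flip _) _ (X_cauchy n i)
  have hgZ (n : ℕ) : g.lTensor M (Z n) ∈ (I ^ n • ⊤ : Submodule R _) := by
    have h1 : ∑ i, f i • X n i ∈ (I ^ n • ⊤ : Submodule R M) := by
      apply strict
      have : ∑ i, f i • (x i - φ (X n i)) ∈ (I ^ n • ⊤ : Submodule R N) :=
        sum_mem fun i _ ↦ Submodule.smul_mem _ _ (hX n i)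
      simpa [smul_sub, hfx] using this
    have h2 : g.lTensor M (Z n) = (TensorProduct.rid R M).symm (∑ i, f i • X n i) := by
      rw [LinearEquiv.eq_symm_apply]
      simp [Z, g, Fintype.linearCombination_apply_single]
    rw [h2]
    exact LinearMap.map_mem_smul_top (TensorProduct.rid R M).symm.toLinearMap _ h1
  choose D hD hgD using fun n ↦ hc n (Z (n + c)) (hgZ _)
  have hY (n : ℕ) : ∃ y, k.lTensor M y = Z (n + c) - D n :=
    (hex _).1 (by rw [map_sub, hgD, sub_self])
  choose Y hY using hY
  have Y_cauchy (n : ℕ) : k.lTensor M (Y (n + d + 1) - Y (n + d)) ∈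
      (I ^ (n + d) • ⊤ : Submodule R _) := by
    have h1 := Submodule.pow_smul_top_le I _ (show n + d ≤ n + d + c by lia) (Z_cauchy (n + d + c))
    have h2 := sub_mem (add_mem h1 (hD (n + d)))
      (Submodule.pow_smul_top_le I _ (Nat.le_succ (n + d)) (hD (n + d + 1)))
    rw [map_sub, hY, hY, show n + d + 1 + c = n + d + c + 1 by ring]
    convert h2 using 1
    abel
  choose E hE hkE using fun n ↦ hd n _ (Y_cauchy n)
  let W (n : ℕ) := Y d + ∑ i ∈ Finset.range n, E i
  have hkW (n : ℕ) : k.lTensor M (W n) = Z (n + d + c) - D (n + d) := by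
    rw [← hY]
    induction n with
    | zero => simp [W]
    | succ n ih =>
      have : W (n + 1) = W n + E n := by simp [W, Finset.sum_range_succ, add_assoc]
      rw [this, map_add, ih, hkE, ← map_add, show n + 1 + d = n + d + 1 by ring]
      simp
  have W_cauchy {a b : ℕ} (hab : a ≤ b) : W b - W a ∈ (I ^ a • ⊤ : Submodule R _) := by
    have : W b - W a = ∑ i ∈ Finset.Ico a b, E i := by
      rw [Finset.sum_Ico_eq_sub _ hab]; simp [W]
    rw [this]
    exact sum_mem fun i hi ↦ Submodule.pow_smul_top_le I _ (Finset.mem_Ico.1 hi).1 (hE i)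
  have hL (j : Fin m) : ∃ L : N, ∀ n, φ (co m j (W n)) ≡ L [SMOD (I ^ n • ⊤ : Submodule R N)] :=
    IsPrecomplete.prec inferInstance fun {a b} hab ↦ by
      rw [SModEq.comm, SModEq.sub_mem, ← map_sub, ← map_sub]
      exact LinearMap.map_mem_smul_top φ _ (LinearMap.map_mem_smul_top (co m j) _ (W_cauchy hab))
  choose L hL using hL
  refine ⟨m, fun i j ↦ k (Pi.single j 1) i, L, fun i ↦ ?_, fun j ↦ ?_⟩
  · rw [← sub_eq_zero]
    refine IsHausdorff.haus (I := I) inferInstance _ fun n ↦ ?_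
    rw [SModEq.zero]
    have h1 : φ (X (n + d + c) i) - φ (co l i (D (n + d))) =
        ∑ j, k (Pi.single j 1) i • φ (co m j (W n)) := by
      have := congrArg (fun z ↦ φ (co l i z)) (hkW n)
      simp only [co_map, map_sum, map_smul, map_sub] at this
      rw [this]
      simp only [Z, co_single]
    have h2 : ∑ j, k (Pi.single j 1) i • (φ (co m j (W n)) - L j) ∈
        (I ^ n • ⊤ : Submodule R N) :=
      sum_mem fun j _ ↦ Submodule.smul_mem _ _ (SModEq.sub_mem.1 (hL j n))
    simp only [smul_sub, Finset.sum_sub_distrib, ← h1] at h2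
    have h3 := Submodule.pow_smul_top_le I _ (show n ≤ n + d + c by lia) (hX (n + d + c) i)
    have h4 := LinearMap.map_mem_smul_top φ _ (LinearMap.map_mem_smul_top (co l i) _
      (Submodule.pow_smul_top_le I _ (show n ≤ n + d by lia) (hD (n + d))))
    convert add_mem (add_mem h3 h4) h2 using 1
    abel
  · have := congrArg (fun u ↦ u (Pi.single j 1)) hgk
    simpa [g, Fintype.linearCombination_apply, mul_comm] using this

namespace PoissonBracket

variable {R B : Type u} [CommRing R] [CommRing B] [Algebra R B]

theorem br_mem_map (P : PoissonBracket R B) (I : Ideal R) {x : B}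
    (hx : x ∈ I.map (algebraMap R B)) (y : B) : P.br x y ∈ I.map (algebraMap R B) := by
  induction hx using Submodule.span_induction with
  | mem x hx =>
    obtain ⟨r, hr, rfl⟩ := hx
    rw [Algebra.algebraMap_eq_smul_one, P.smul_left, Algebra.smul_def]
    exact Ideal.mul_mem_right _ _ (Ideal.mem_map_of_mem _ hr)
  | zero =>
    have : P.br 0 y = 0 := by simpa using P.smul_left 0 0 y
    rw [this]
    exact zero_mem _
  | add a b _ _ ha hb =>
    rw [P.add_left]
    exact add_mem ha hb
  | smul b a hb ha =>
    rw [smul_eq_mul, P.leibniz_left]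
    exact add_mem (Ideal.mul_mem_left _ _ hb) (Ideal.mul_mem_left _ _ ha)

theorem br_mk_congr (P : PoissonBracket R B) (I : Ideal R) {n : ℕ} {a a' b b' : B}
    (ha : Submodule.Quotient.mk (p := ((I.map (algebraMap R B)) ^ n • ⊤ : Ideal B)) a =
      Submodule.Quotient.mk a')
    (hb : Submodule.Quotient.mk (p := ((I.map (algebraMap R B)) ^ n • ⊤ : Ideal B)) b =
      Submodule.Quotient.mk b') :
    Submodule.Quotient.mk (p := ((I.map (algebraMap R B)) ^ n • ⊤ : Ideal B)) (P.br a b) =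
      Submodule.Quotient.mk (P.br a' b') := by
  simp only [Submodule.Quotient.eq, smul_eq_mul, Ideal.mul_top, ← Ideal.map_pow] at ha hb ⊢
  have h1 := P.br_mem_map _ ha b
  have h2 := P.br_mem_map _ hb a'
  have e1 : P.br a b = P.br (a - a') b + P.br a' b := by rw [← P.add_left, sub_add_cancel]
  have e2 : P.br a' b = - P.br (b - b') a' + P.br a' b' := by
    rw [← P.antisymm, ← P.add_right, sub_add_cancel]
  rw [e1, e2]
  convert sub_mem h1 h2 using 1
  ring

/-- A Poisson bracket extends to the adic completion with respect to an ideal of the base ring. -/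
theorem exists_adicCompletion (P : PoissonBracket R B) (I : Ideal R) :
    ∃ Q : PoissonBracket R (AdicCompletion (I.map (algebraMap R B)) B),
      ∀ x y n a b, x.val n = Submodule.Quotient.mk a → y.val n = Submodule.Quotient.mk b →
        (Q.br x y).val n = Submodule.Quotient.mk (P.br a b) := by
  set J := I.map (algebraMap R B) with hJ
  have hex (x : AdicCompletion J B) (n : ℕ) : ∃ a : B, x.val n = Submodule.Quotient.mk a :=
    (Submodule.Quotient.mk_surjective _ (x.val n)).imp fun _ h ↦ h.symm
  choose r hr using hex
  let br (x y : AdicCompletion J B) : AdicCompletion J B :=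
    { val := fun n ↦ Submodule.Quotient.mk (P.br (r x n) (r y n))
      property := fun {m n} hmn ↦ by
        have h (z : AdicCompletion J B) :
            Submodule.Quotient.mk (p := (J ^ m • ⊤ : Ideal B)) (r z n) =
              Submodule.Quotient.mk (r z m) := by
          rw [← hr z m, ← z.property hmn, hr z n]
          rfl
        exact P.br_mk_congr I (h x) (h y) }
  have key (x y : AdicCompletion J B) (n : ℕ) (a b : B) (ha : x.val n = Submodule.Quotient.mk a)
      (hb : y.val n = Submodule.Quotient.mk b) :
      (br x y).val n = Submodule.Quotient.mk (P.br a b) :=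
    P.br_mk_congr I ((hr x n).symm.trans ha) ((hr y n).symm.trans hb)
  refine ⟨{
    br := br
    add_left := fun x y z ↦ ?_
    smul_left := fun s x z ↦ ?_
    antisymm := fun x y ↦ ?_
    jacobi := fun x y z ↦ ?_
    leibniz := fun x y z ↦ ?_ }, key⟩
  all_goals refine AdicCompletion.ext fun n ↦ ?_
  · rw [key (x + y) z n (r x n + r y n) (r z n)
      (by rw [AdicCompletion.val_add_apply, hr x, hr y]; rfl) (hr z n),
      P.add_left]
    rfl
  · rw [key (s • x) z n (s • r x n) (r z n)
      (by rw [AdicCompletion.val_smul_apply, hr x]; rfl) (hr z n),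
      P.smul_left]
    rfl
  · rw [AdicCompletion.val_neg_apply, key x y n _ _ (hr x n) (hr y n),
      key y x n _ _ (hr y n) (hr x n), P.antisymm]
    rfl
  · rw [AdicCompletion.val_add_apply, AdicCompletion.val_add_apply,
      key x _ n _ _ (hr x n) (key y z n _ _ (hr y n) (hr z n)),
      key y _ n _ _ (hr y n) (key z x n _ _ (hr z n) (hr x n)),
      key z _ n _ _ (hr z n) (key x y n _ _ (hr x n) (hr y n)),
      ← Submodule.Quotient.mk_add, ← Submodule.Quotient.mk_add, P.jacobi]
    rfl
  · rw [key x (y * z) n (r x n) (r y n * r z n) (hr x n)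
      (by rw [AdicCompletion.val_mul, hr y, hr z]; rfl), P.leibniz, AdicCompletion.val_add_apply,
      AdicCompletion.val_mul, AdicCompletion.val_mul, hr y n, hr z n,
      key x y n _ _ (hr x n) (hr y n), key x z n _ _ (hr x n) (hr z n)]
    rfl

end PoissonBracket

section AdicCompletion

variable {R B : Type*} [CommRing R] [CommRing B] [Algebra R B] (I : Ideal R)

theorem AdicCompletion.mem_pow_smul_top_iff_val (hI : I.FG) (n : ℕ)
    (x : AdicCompletion (I.map (algebraMap R B)) B) :
    x ∈ (I ^ n • ⊤ : Submodule R (AdicCompletion (I.map (algebraMap R B)) B)) ↔ x.val n = 0 := by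
  have h := AdicCompletion.pow_smul_top_eq_ker_eval (M := B) (n := n) (hI.map (algebraMap R B))
  have h2 := Submodule.restrictScalars_map_smul_eq (R := B) (I ^ n)
    (⊤ : Submodule B (AdicCompletion (I.map (algebraMap R B)) B))
  rw [Ideal.map_pow, h, Submodule.restrictScalars_top] at h2
  rw [← h2]
  rfl

theorem AdicCompletion.isAdicComplete_of_map (hI : I.FG) :
    IsAdicComplete I (AdicCompletion (I.map (algebraMap R B)) B) :=
  have := AdicCompletion.isAdicComplete (M := B) (hI.map (algebraMap R B))
  (IsAdicComplete.map_algebraMap_iff I _).1 this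

theorem Module.Flat.adicCompletion_map [IsNoetherianRing R] [Module.Flat R B] :
    Module.Flat R (AdicCompletion (I.map (algebraMap R B)) B) := by
  have hI : I.FG := IsNoetherian.noetherian I
  have := AdicCompletion.isAdicComplete_of_map (B := B) I hI
  refine Module.Flat.of_dense_of_isAdicComplete I
    ((AdicCompletion.of (I.map (algebraMap R B)) B).restrictScalars R) (fun n x ↦ ?_)
    (fun n y hy ↦ ?_)
  · obtain ⟨y, hy⟩ := Submodule.Quotient.mk_surjective _ (x.val n)
    refine ⟨y, ?_⟩
    rw [AdicCompletion.mem_pow_smul_top_iff_val I hI, AdicCompletion.val_sub_apply, ← hy]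
    exact sub_self _
  · rw [AdicCompletion.mem_pow_smul_top_iff_val I hI] at hy
    have h := (Submodule.Quotient.mk_eq_zero _).1 hy
    have h2 := Submodule.restrictScalars_map_smul_eq (R := B) (I ^ n) (⊤ : Submodule B B)
    rw [Submodule.restrictScalars_top, Ideal.map_pow] at h2
    rw [← h2]
    exact h

end AdicCompletion

/-- A surjection `ψ : A → C` whose kernel is extended from an ideal `I` of the base ring induces a
surjection `A[a⁻¹] → C[(ψ a)⁻¹]` whose kernel is again extended from `I`. -/
theorem IsLocalization.Away.exists_lift_surjective {K R A B C C' : Type*} [CommRing K]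
    [CommRing R] [CommRing A] [CommRing B] [CommRing C] [CommRing C'] [Algebra R A] [Algebra R B]
    [Algebra A B] [IsScalarTower R A B] [Algebra K A] [Algebra K B] [IsScalarTower K A B]
    [Algebra K C] [Algebra K C'] [Algebra C C'] [IsScalarTower K C C'] (I : Ideal R)
    (ψ : A →ₐ[K] C) (hψ : Function.Surjective ψ)
    (hker : ∀ x, ψ x = 0 ↔ x ∈ I.map (algebraMap R A)) (a : A)
    [IsLocalization.Away a B] [IsLocalization.Away (ψ a) C'] :
    ∃ π : B →ₐ[K] C', Function.Surjective π ∧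
      (∀ x, π x = 0 ↔ x ∈ I.map (algebraMap R B)) ∧
      ∀ x, π (algebraMap A B x) = algebraMap C C' (ψ x) := by
  let f : A →ₐ[K] C' := (IsScalarTower.toAlgHom K C C').comp ψ
  have hf (y : Submonoid.powers a) : IsUnit (f y) := by
    obtain ⟨_, n, rfl⟩ := y
    simpa [f] using (IsLocalization.Away.algebraMap_isUnit (S := C') (ψ a)).pow n
  let π : B →ₐ[K] C' := IsLocalization.liftAlgHom (M := Submonoid.powers a) (f := f) hf
  have hπ (x : A) : π (algebraMap A B x) = algebraMap C C' (ψ x) :=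
    IsLocalization.lift_eq (M := Submonoid.powers a) (g := f.toRingHom) hf x
  have hIB : I.map (algebraMap R B) = (I.map (algebraMap R A)).map (algebraMap A B) := by
    rw [Ideal.map_map, ← IsScalarTower.algebraMap_eq]
  have hu : IsUnit (algebraMap A B a) := IsLocalization.Away.algebraMap_isUnit a
  have hu' : IsUnit (algebraMap C C' (ψ a)) := IsLocalization.Away.algebraMap_isUnit (ψ a)
  refine ⟨π, fun y ↦ ?_, fun x ↦ ⟨fun hx ↦ ?_, fun hx ↦ ?_⟩, hπ⟩
  · obtain ⟨n, c, hc⟩ := IsLocalization.Away.surj (ψ a) y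
    obtain ⟨x, rfl⟩ := hψ c
    obtain ⟨v, hv⟩ := (hu.pow n).exists_right_inv
    refine ⟨algebraMap A B x * v, (hu'.pow n).mul_right_cancel ?_⟩
    rw [hc, ← hπ a, ← map_pow, ← map_mul, ← hπ, mul_assoc, mul_comm v, hv, mul_one]
  · obtain ⟨n, y, hy⟩ := IsLocalization.Away.surj a x
    have h1 : algebraMap C C' (ψ y) = 0 := by rw [← hπ, ← hy, map_mul, hx, zero_mul]
    rw [IsLocalization.map_eq_zero_iff (Submonoid.powers (ψ a))] at h1
    obtain ⟨⟨_, k, rfl⟩, hk⟩ := h1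
    have h2 : a ^ k * y ∈ I.map (algebraMap R A) := (hker _).1 (by simpa using hk)
    have h3 := Ideal.mem_map_of_mem (algebraMap A B) h2
    rw [← hIB, map_mul, map_pow, ← hy] at h3
    exact (Ideal.mul_unit_mem_iff_mem _ (hu.pow n)).1
      ((Ideal.unit_mul_mem_iff_mem _ (hu.pow k)).1 h3)
  · rw [hIB] at hx
    have : (I.map (algebraMap R A)).map (algebraMap A B) ≤ RingHom.ker π := by
      rw [Ideal.map_le_iff_le_comap]
      intro z hz
      rw [Ideal.mem_comap, RingHom.mem_ker, hπ, (hker z).2 hz, map_zero]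
    exact this hx

/-- A ring homomorphism from a localization which kills the brackets of elements of the base ring
kills all brackets. -/
theorem PoissonBracket.map_br_eq_zero_of_isLocalization {R B : Type u} {A D : Type*}
    [CommRing R] [CommRing A] [CommRing B] [CommRing D] [Algebra R B] [Algebra A B]
    (S : Submonoid A) [IsLocalization S B]
    (Q : PoissonBracket R B) (π : B →+* D)
    (h : ∀ x y : A, π (Q.br (algebraMap A B x) (algebraMap A B y)) = 0) (x y : B) :
    π (Q.br x y) = 0 := by
  let := Module.compHom D π
  have hs (b : B) (d : D) : b • d = π b * d := rfl
  refine IsLocalization.eq_zero_of_leibniz S (f := fun y ↦ π (Q.br x y)) (fun y z ↦ ?_)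
    (fun y ↦ ?_) y
  · rw [Q.leibniz, hs, hs, map_add, map_mul, map_mul]
    ring
  · refine IsLocalization.eq_zero_of_leibniz S (f := fun x ↦ π (Q.br x (algebraMap A B y)))
      (fun y z ↦ ?_) (fun x ↦ h x y) x
    rw [Q.leibniz_left, hs, hs, map_add, map_mul, map_mul]
    ring
/-- Let `K` be a field, `(R, 𝔪)` a parameter `K`-algebra, `C` a
commutative `K`-algebra (regarded as a Poisson algebra with zero bracket), `A` a Poisson
`R`-deformation of `C` (a flat, `𝔪`-adically complete commutative Poisson `R`-algebra,
with surjective `K`-algebra augmentation `ψ : A → C` whose kernel is `𝔪A` and which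
kills the bracket) and `τ : C → C'` a principal localization.  Then there exist a Poisson
`R`-deformation `A'` of `C'` and a homomorphism of Poisson `R`-algebras `g : A → A'`
lifting `τ`, i.e. compatible with the augmentations `A → C` and `A' → C'`. -/
theorem stmt_6
    (K : Type u) [Field K]
    (R : Type u) [CommRing R] [Algebra K R] [IsLocalRing R] [IsNoetherianRing R]
    (hres : Function.Bijective (algebraMap K (IsLocalRing.ResidueField R)))
    [IsAdicComplete (IsLocalRing.maximalIdeal R) R]
    (C : Type u) [CommRing C] [Algebra K C]
    (A : Type u) [CommRing A] [Algebra R A] [Algebra K A] [IsScalarTower K R A]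
    [Module.Flat R A] [IsAdicComplete (IsLocalRing.maximalIdeal R) A]
    (P : PoissonBracket R A)
    (ψ : A →ₐ[K] C) (hψsurj : Function.Surjective ψ)
    (hψker : ∀ x : A, ψ x = 0 ↔ x ∈ (IsLocalRing.maximalIdeal R) • (⊤ : Submodule R A))
    (hψbr : ∀ x y : A, ψ (P.br x y) = 0)
    (C' : Type u) [CommRing C'] [Algebra K C'] [Algebra C C'] [IsScalarTower K C C']
    (s : C) [IsLocalization.Away s C'] :
    ∃ (A' : Type u) (_ : CommRing A') (_ : Algebra R A') (_ : Algebra K A')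
        (_ : IsScalarTower K R A'),
      Module.Flat R A' ∧ IsAdicComplete (IsLocalRing.maximalIdeal R) A' ∧
      ∃ (P' : PoissonBracket R A') (ψ' : A' →ₐ[K] C') (g : A →ₐ[R] A'),
        Function.Surjective ψ' ∧
        (∀ x : A', ψ' x = 0 ↔
          x ∈ (IsLocalRing.maximalIdeal R) • (⊤ : Submodule R A')) ∧
        (∀ x y : A', ψ' (P'.br x y) = 0) ∧
        -- `g` respects the Poisson brackets
        (∀ x y : A, g (P.br x y) = P'.br (g x) (g y)) ∧
        -- `g` lifts `τ : C → C'`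
        (∀ x : A, ψ' (g x) = algebraMap C C' (ψ x)) := by
  have hm : (IsLocalRing.maximalIdeal R).FG := IsNoetherian.noetherian _
  set m := IsLocalRing.maximalIdeal R
  have hmap {D : Type u} [CommRing D] [Algebra R D] (x : D) :
      x ∈ (m • ⊤ : Submodule R D) ↔ x ∈ m.map (algebraMap R D) := by
    rw [Ideal.smul_top_eq_map]
    rfl
  obtain ⟨a, rfl⟩ := hψsurj s
  let B := Localization.Away a
  have : Module.Flat A B := IsLocalization.flat B (Submonoid.powers a)
  have : Module.Flat R B := Module.Flat.trans R A B
  obtain ⟨π, hπsurj, hπker, hπ⟩ := IsLocalization.Away.exists_lift_surjective (B := B) (C' := C')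
    m ψ hψsurj (fun x ↦ (hψker x).trans (hmap x)) a
  obtain ⟨Q, hQ⟩ := P.exists_extend_localization (B := B) (Submonoid.powers a)
  have hQπ (x y : B) : π (Q.br x y) = 0 :=
    Q.map_br_eq_zero_of_isLocalization (Submonoid.powers a) π.toRingHom
      (fun x y ↦ by
        change π _ = 0
        rw [hQ, hπ, hψbr, map_zero]) x y
  let J := m.map (algebraMap R B)
  obtain ⟨P', hP'⟩ := Q.exists_adicCompletion m
  let ρ : B ⧸ J →ₐ[K] C' := Ideal.Quotient.liftₐ J π fun x hx ↦ (hπker x).2 hx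
  let ψ' : AdicCompletion J B →ₐ[K] C' := ρ.comp ((AdicCompletion.evalOneₐ J).restrictScalars K)
  have hψ' (x : AdicCompletion J B) (b : B) (hb : x.val 1 = Submodule.Quotient.mk b) :
      ψ' x = π b := by
    have h : AdicCompletion.evalOneₐ J x = Ideal.Quotient.mk J b := by
      rw [← AdicCompletion.evalOneₐ_of J b]
      exact congrArg (fun z ↦ Ideal.Quotient.factor (show J ^ 1 ≤ J by simp)
        (Ideal.quotientEquivAlgOfEq B (show J ^ 1 • ⊤ = J ^ 1 by simp) z)) hb
    change ρ (AdicCompletion.evalOneₐ J x) = π b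
    rw [h]
    rfl
  refine ⟨AdicCompletion J B, inferInstance, inferInstance, inferInstance, inferInstance,
    Module.Flat.adicCompletion_map m, AdicCompletion.isAdicComplete_of_map m hm, P', ψ',
    (Algebra.algHom R B (AdicCompletion J B)).comp (Algebra.algHom R A B),
    fun c ↦ ?_, fun x ↦ ?_, fun x y ↦ ?_, fun x y ↦ ?_, fun x ↦ ?_⟩
  · obtain ⟨b, rfl⟩ := hπsurj c
    exact ⟨AdicCompletion.of J B b, hψ' _ b rfl⟩
  · obtain ⟨b, hb⟩ := Submodule.Quotient.mk_surjective _ (x.val 1)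
    rw [hψ' x b hb.symm, hπker, ← pow_one m, AdicCompletion.mem_pow_smul_top_iff_val m hm, ← hb,
      pow_one, Submodule.Quotient.mk_eq_zero, pow_one, smul_eq_mul, Ideal.mul_top]
  · obtain ⟨b, hb⟩ := Submodule.Quotient.mk_surjective _ (x.val 1)
    obtain ⟨c, hc⟩ := Submodule.Quotient.mk_surjective _ (y.val 1)
    rw [hψ' _ _ (hP' x y 1 b c hb.symm hc.symm), hQπ]
  · refine AdicCompletion.ext fun n ↦ ?_
    refine Eq.trans ?_ (hP' _ _ n (algebraMap A B x) (algebraMap A B y) rfl rfl).symm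
    rw [hQ]
    rfl
  · exact (hψ' _ (algebraMap A B x) rfl).trans (hπ x)
end

section
/- Let K be a field, R a parameter K-algebra, C a commutative K-algebra, and A an associative R-deformation of C. Let (R', m') be another parameter K-algebra, σ : R → R' a K-algebra homomorphism, and define A' := lim_i (R'_i ⊗_R A), where R'_i := R'/m'^{i+1}. Then A', with the multiplication induced componentwise from that of A, is an associative R'-deformation of C (it is an associative unital R'-algebra, flat over R' and m'-adically complete, with augmentation K ⊗_{R'} A' ≅ C), and the canonical map A → A' is an R-algebra homomorphism compatible with the augmentations to C. -/
universe u
set_option synthInstance.maxHeartbeats 1000000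
set_option maxHeartbeats 1000000
open TensorProduct

section BaseChange

variable (R : Type u) [CommRing R]
variable (R' : Type u) [CommRing R'] [Algebra R R'] (m' : Ideal R')
variable (A : Type u) [Ring A] [Algebra R A]

/-- `R'_i ⊗_R A`, where `R'_i := R'/𝔪'^{i+1}`. -/
abbrev baseChangePiece (i : ℕ) : Type u := (R' ⧸ (m' ^ (i + 1))) ⊗[R] A

/-- The transition maps `R'_{i+1} ⊗_R A → R'_i ⊗_R A`. -/
noncomputable def baseChangeTrans (i : ℕ) :
    baseChangePiece R R' m' A (i + 1) →ₐ[R] baseChangePiece R R' m' A i :=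
  Algebra.TensorProduct.map
    (Ideal.quotientMapₐ _ (AlgHom.id R R')
      (by simpa using Ideal.pow_le_pow_right (Nat.le_succ (i + 1))))
    (AlgHom.id R A)

/-- The completed base change `R' ⊗̂_R A = lim_i (R'_i ⊗_R A)`, realized as the
`R'`-subalgebra of compatible families in the product `∏_i R'_i ⊗_R A`. -/
noncomputable def completedBaseChange :
    Subalgebra R' (∀ i : ℕ, baseChangePiece R R' m' A i) where
  carrier := {f | ∀ i, baseChangeTrans R R' m' A i (f (i + 1)) = f i}
  mul_mem' := fun hf hg i => by simp only [Pi.mul_apply, map_mul]; rw [hf i, hg i]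
  add_mem' := fun hf hg i => by simp only [Pi.add_apply, map_add]; rw [hf i, hg i]
  algebraMap_mem' := fun r i => by
    simp only [Pi.algebraMap_apply]
    have h1 : algebraMap R' (baseChangePiece R R' m' A (i + 1)) r =
        (Ideal.Quotient.mk (m' ^ (i + 2)) r) ⊗ₜ[R] (1 : A) := rfl
    have h2 : algebraMap R' (baseChangePiece R R' m' A i) r =
        (Ideal.Quotient.mk (m' ^ (i + 1)) r) ⊗ₜ[R] (1 : A) := rfl
    rw [h1, h2, baseChangeTrans, Algebra.TensorProduct.map_tmul]
    simp [Ideal.quotientMapₐ]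

/-- The canonical map `A → R' ⊗̂_R A`, `x ↦ (1 ⊗ x)_i`. -/
noncomputable def canonicalBaseChange (x : A) : completedBaseChange R R' m' A :=
  ⟨fun i => (1 : R' ⧸ (m' ^ (i + 1))) ⊗ₜ[R] x,
    fun i => by
      rw [baseChangeTrans, Algebra.TensorProduct.map_tmul]
      simp⟩

end BaseChange


theorem lTensor_exists_mem_pow_smul_top {R : Type*} [CommRing R] [IsNoetherianRing R] (I : Ideal R)
    (B : Type*) [AddCommGroup B] [Module R B] [Module.Flat R B]
    {P Q : Type*} [AddCommGroup P] [Module R P] [AddCommGroup Q] [Module R Q]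
    [Module.Finite R Q] (φ : P →ₗ[R] Q) :
    ∃ k : ℕ, ∀ n : ℕ, ∀ x : B ⊗[R] P,
      φ.lTensor B x ∈ (I ^ (n + k) • ⊤ : Submodule R (B ⊗[R] Q)) →
      ∃ y ∈ (I ^ n • ⊤ : Submodule R (B ⊗[R] P)), φ.lTensor B y = φ.lTensor B x := by
  obtain ⟨k, hk⟩ := Ideal.exists_pow_inf_eq_pow_smul I (LinearMap.range φ)
  refine ⟨k, fun n x hx => ?_⟩
  set N : Submodule R Q := I ^ (n + k) • ⊤ with hN
  have hex : Function.Exact ((N.comap φ).subtype.lTensor B) ((N.mkQ ∘ₗ φ).lTensor B) := by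
    apply Module.Flat.lTensor_exact
    intro p
    simp
  have hle : N.comap φ ≤ LinearMap.ker φ ⊔ I ^ n • ⊤ := by
    intro p hp
    have h1 : φ p ∈ I ^ n • LinearMap.range φ := by
      have := (hk (n + k) (by omega)).le ⟨hp, ⟨p, rfl⟩⟩
      rw [Nat.add_sub_cancel] at this
      exact Submodule.smul_mono le_rfl inf_le_right this
    rw [LinearMap.range_eq_map, ← Submodule.map_smul''] at h1
    obtain ⟨q, hq, hqp⟩ := h1
    rw [← sub_add_cancel p q]
    exact Submodule.add_mem_sup (by simp [hqp]) hq
  have hx0 : (N.mkQ ∘ₗ φ).lTensor B x = 0 := by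
    rw [LinearMap.lTensor_comp_apply]
    have h2 := Submodule.mem_map_of_mem (f := N.mkQ.lTensor B) hx
    rw [Submodule.map_smul''] at h2
    rw [← Submodule.mem_bot R]
    refine Submodule.smul_le.2 (fun r hr z hz => ?_) h2
    clear hz
    rw [Submodule.mem_bot]
    induction z with
    | zero => simp
    | add a b ha hb => rw [smul_add, ha, hb, add_zero]
    | tmul b q =>
      obtain ⟨q, rfl⟩ := N.mkQ_surjective q
      have hq : N.mkQ (r • q) = 0 :=
        (Submodule.Quotient.mk_eq_zero N).2 (Submodule.smul_mem_smul hr Submodule.mem_top)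
      rw [← TensorProduct.tmul_smul, ← map_smul, hq, tmul_zero]
  obtain ⟨w, rfl⟩ := (hex x).1 hx0
  clear hx hx0
  induction w with
  | zero => exact ⟨0, zero_mem _, by simp⟩
  | add a b ha hb =>
    obtain ⟨y, hy, hy'⟩ := ha
    obtain ⟨z, hz, hz'⟩ := hb
    exact ⟨y + z, add_mem hy hz, by simp [hy', hz']⟩
  | tmul b p =>
    obtain ⟨q, hq, s, hs, hqs⟩ := Submodule.mem_sup.1 (hle p.2)
    refine ⟨b ⊗ₜ s, ?_, ?_⟩
    · have h3 := Submodule.mem_map_of_mem (f := TensorProduct.mk R B P b) hs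
      rw [Submodule.map_smul''] at h3
      exact Submodule.smul_mono le_rfl le_top h3
    · rw [LinearMap.mem_ker] at hq
      simp [← hqs, hq]

namespace AdicCompletion

theorem map_exact_of_exists_mem_pow_smul_top {R : Type*} [CommRing R] (I : Ideal R)
    {M N P : Type*} [AddCommGroup M] [Module R M] [AddCommGroup N] [Module R N]
    [AddCommGroup P] [Module R P] {u : M →ₗ[R] N} {v : N →ₗ[R] P} (huv : Function.Exact u v)
    (hu : ∃ k : ℕ, ∀ n : ℕ, ∀ x : M, u x ∈ (I ^ (n + k) • ⊤ : Submodule R N) →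
      ∃ y ∈ (I ^ n • ⊤ : Submodule R M), u y = u x)
    (hv : ∃ k : ℕ, ∀ n : ℕ, ∀ x : N, v x ∈ (I ^ (n + k) • ⊤ : Submodule R P) →
      ∃ y ∈ (I ^ n • ⊤ : Submodule R N), v y = v x)
    (x : AdicCompletion I N) (hx : map I v x = 0) : ∃ y, map I u y = x := by
  obtain ⟨k, hu⟩ := hu
  obtain ⟨l, hv⟩ := hv
  induction x using AdicCompletion.induction_on with | _ b
  have hb (n : ℕ) : v (b n) ∈ (I ^ n • ⊤ : Submodule R P) := by
    simpa using congrArg (fun x ↦ x.val n) hx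
  choose y hy hyv using fun n => hv n (b (n + l)) (hb _)
  choose a ha using fun n => (huv (b (n + l) - y n)).1 (by simp [hyv])
  have hmono {m n : ℕ} (h : m ≤ n) : (I ^ n • ⊤ : Submodule R N) ≤ I ^ m • ⊤ :=
    Submodule.smul_mono_left (Ideal.pow_le_pow_right h)
  have hbsub {m n : ℕ} (h : m ≤ n) : b n - b m ∈ (I ^ m • ⊤ : Submodule R N) := by
    rw [← Submodule.Quotient.eq]
    exact AdicCauchySequence.mk_eq_mk h _
  have hstep (n : ℕ) : u (a (n + 1 + k) - a (n + k)) ∈ (I ^ (n + k) • ⊤ : Submodule R N) := by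
    rw [map_sub, ha, ha, sub_sub_sub_comm]
    exact sub_mem (hmono (by omega) (hbsub (m := n + k + l) (by omega)))
      (sub_mem (hmono (by omega) (hy _)) (hy _))
  choose d hd hdu using fun n => hu n _ (hstep n)
  have he (n : ℕ) : u (a k + ∑ i ∈ Finset.range n, d i) = u (a (n + k)) := by
    induction n with
    | zero => simp
    | succ n ih => rw [Finset.sum_range_succ, ← add_assoc, map_add, ih, hdu, map_sub]; abel
  refine ⟨AdicCompletion.mk I M (AdicCauchySequence.mk I M
    (fun n => a k + ∑ i ∈ Finset.range n, d i) fun n => ?_), ?_⟩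
  · rw [SModEq.comm, SModEq.sub_mem, Finset.sum_range_succ, ← add_assoc, add_sub_cancel_left]
    exact hd n
  · ext n
    suffices h : Submodule.Quotient.mk (p := (I ^ n • ⊤ : Submodule R N))
        (u (a k + ∑ i ∈ Finset.range n, d i)) = Submodule.Quotient.mk (b n) by
      simpa using h
    rw [Submodule.Quotient.eq, he, ha, sub_right_comm]
    exact sub_mem (hbsub (by omega)) (hmono (by omega) (hy _))

theorem map_sum_smul_apply {R : Type*} [CommRing R] (I : Ideal R) {M N : Type*} [AddCommGroup M]
    [Module R M] [AddCommGroup N] [Module R N] {κ : Type*} (s : Finset κ) (c : κ → R)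
    (g : κ → M →ₗ[R] N) (y : AdicCompletion I M) :
    map I (∑ j ∈ s, c j • g j) y = ∑ j ∈ s, c j • map I (g j) y := by
  induction y using AdicCompletion.induction_on with | _ b
  ext n
  simp [LinearMap.sum_apply, val_smul_apply]

theorem map_smul_apply {R : Type*} [CommRing R] (I : Ideal R) {M N : Type*} [AddCommGroup M]
    [Module R M] [AddCommGroup N] [Module R N] (c : R) (g : M →ₗ[R] N) (y : AdicCompletion I M) :
    map I (c • g) y = c • map I g y := by
  simpa using map_sum_smul_apply I {()} (fun _ => c) (fun _ => g) y

theorem flat_of_flat {R : Type*} [CommRing R] [IsNoetherianRing R] (I : Ideal R)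
    (B : Type*) [AddCommGroup B] [Module R B] [Module.Flat R B] :
    Module.Flat R (AdicCompletion I B) := by
  refine Module.Flat.of_forall_isTrivialRelation fun {l f x} hfx => ?_
  let φ : (Fin l → R) →ₗ[R] R := Fintype.linearCombination R f
  obtain ⟨p, z, hz⟩ := Module.Finite.exists_fin' R (LinearMap.ker φ)
  let ζ : (Fin p → R) →ₗ[R] (Fin l → R) := (LinearMap.ker φ).subtype ∘ₗ z
  have hζφ : Function.Exact ζ φ := by
    rw [LinearMap.exact_iff, LinearMap.range_comp, LinearMap.range_eq_top.2 hz]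
    simp
  let ι (i : Fin l) : B →ₗ[R] B ⊗[R] (Fin l → R) := (TensorProduct.mk R B _).flip (Pi.single i 1)
  let π {n : ℕ} (i : Fin n) : B ⊗[R] (Fin n → R) →ₗ[R] B :=
    TensorProduct.rid R B ∘ₗ (LinearMap.proj i).lTensor B
  have hX : map I (φ.lTensor B) (∑ i, map I (ι i) (x i)) = 0 := by
    have h (i) : map I (φ.lTensor B) (map I (ι i) (x i)) =
        f i • map I ((TensorProduct.mk R B R).flip 1) (x i) := by
      rw [map_comp_apply, ← map_smul_apply]
      congr 2
      ext b
      simp [ι, φ, Fintype.linearCombination_apply, ← TensorProduct.tmul_smul, Pi.single_apply]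
    rw [map_sum, Finset.sum_congr rfl fun i _ => h i]
    simp_rw [← LinearMap.map_smul_of_tower]
    rw [← map_sum, hfx, _root_.map_zero]
  obtain ⟨Y, hY⟩ := map_exact_of_exists_mem_pow_smul_top I
    (Module.Flat.lTensor_exact B hζφ) (lTensor_exists_mem_pow_smul_top I B ζ)
    (lTensor_exists_mem_pow_smul_top I B φ) _ hX
  refine ⟨p, fun i j => ζ (Pi.single j 1) i, fun j => map I (π j) Y, fun i => ?_, fun j => ?_⟩
  · have h := congrArg (map I (π i)) hY
    have h1 (j) : map I (π i) (map I (ι j) (x j)) = if i = j then x j else 0 := by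
      have h2 : π i ∘ₗ ι j = if i = j then LinearMap.id else 0 := by
        ext b
        simp only [π, ι]
        split_ifs with hij <;> simp [hij]
      rw [map_comp_apply, h2]
      split_ifs <;> simp
    have h3 : π i ∘ₗ ζ.lTensor B = ∑ j, ζ (Pi.single j 1) i • π j := by
      ext b j
      simp [π, Pi.single_apply, LinearMap.sum_apply]
    rw [map_sum, Finset.sum_congr rfl fun j _ => h1 j, map_comp_apply, h3,
      map_sum_smul_apply] at h
    simpa using h.symm
  · have := hζφ.apply_apply_eq_zero (Pi.single j 1)
    simpa [φ, Fintype.linearCombination_apply, mul_comm] using this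

end AdicCompletion

theorem LinearEquiv.apply_mem_smul_top_iff {S : Type*} [CommSemiring S] {M N : Type*}
    [AddCommMonoid M] [Module S M] [AddCommMonoid N] [Module S N] (e : M ≃ₗ[S] N) (J : Ideal S)
    (x : M) : e x ∈ (J • ⊤ : Submodule S N) ↔ x ∈ (J • ⊤ : Submodule S M) := by
  rw [← e.range, LinearMap.range_eq_map, ← Submodule.map_smul'']
  exact e.injective.mem_set_image

theorem IsAdicComplete.of_linearEquiv {S : Type*} [CommRing S] (I : Ideal S) {M N : Type*}
    [AddCommGroup M] [Module S M] [AddCommGroup N] [Module S N] (e : M ≃ₗ[S] N)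
    [IsAdicComplete I M] : IsAdicComplete I N where
  haus' x hx := by
    rw [← e.symm.map_eq_zero_iff]
    refine IsHausdorff.haus' (I := I) _ fun n => ?_
    rw [SModEq.zero, LinearEquiv.apply_mem_smul_top_iff, ← SModEq.zero]
    exact hx n
  prec' f hf := by
    obtain ⟨L, hL⟩ := IsPrecomplete.prec' (I := I) (fun n => e.symm (f n)) fun {m n} h => by
      rw [SModEq.sub_mem, ← map_sub, LinearEquiv.apply_mem_smul_top_iff, ← SModEq.sub_mem]
      exact hf h
    refine ⟨e L, fun n => ?_⟩
    rw [SModEq.sub_mem, ← e.symm.apply_mem_smul_top_iff, map_sub, e.symm_apply_apply,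
      ← SModEq.sub_mem]
    exact hL n

section BaseChange

variable (R : Type u) [CommRing R]
variable (R' : Type u) [CommRing R'] [Algebra R R'] (m' : Ideal R')
variable (A : Type u) [Ring A] [Algebra R A]

/-- The identification `(R' ⊗_R A) / 𝔪'^{i+1} ≃ R'_i ⊗_R A`. -/
noncomputable def quotientEquivBaseChangePiece (i : ℕ) :
    ((R' ⊗[R] A) ⧸ (m' ^ (i + 1) • ⊤ : Submodule R' (R' ⊗[R] A))) ≃ₗ[R']
      baseChangePiece R R' m' A i :=
  (TensorProduct.quotTensorEquivQuotSMul (R' ⊗[R] A) (m' ^ (i + 1))).symm ≪≫ₗ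
    TensorProduct.AlgebraTensorModule.cancelBaseChange R R' R' (R' ⧸ (m' ^ (i + 1))) A

theorem quotientEquivBaseChangePiece_mk_tmul (i : ℕ) (r : R') (a : A) :
    quotientEquivBaseChangePiece R R' m' A i (Submodule.Quotient.mk (r ⊗ₜ[R] a)) =
      Ideal.Quotient.mk (m' ^ (i + 1)) r ⊗ₜ[R] a := by
  simp only [quotientEquivBaseChangePiece, LinearEquiv.trans_apply,
    TensorProduct.quotTensorEquivQuotSMul_symm_mk,
    TensorProduct.AlgebraTensorModule.cancelBaseChange_tmul]
  rw [Algebra.smul_def, mul_one, Ideal.Quotient.algebraMap_eq]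

theorem baseChangeTrans_quotientEquiv_mk (i : ℕ) (b : R' ⊗[R] A) :
    baseChangeTrans R R' m' A i
        (quotientEquivBaseChangePiece R R' m' A (i + 1) (Submodule.Quotient.mk b)) =
      quotientEquivBaseChangePiece R R' m' A i (Submodule.Quotient.mk b) := by
  induction b with
  | zero => simp
  | add x y hx hy => simp only [Submodule.Quotient.mk_add, map_add, hx, hy]
  | tmul r a =>
    rw [quotientEquivBaseChangePiece_mk_tmul, quotientEquivBaseChangePiece_mk_tmul,
      baseChangeTrans, Algebra.TensorProduct.map_tmul]
    rfl

/-- The comparison map from the `𝔪'`-adic completion of `R' ⊗_R A` to the completed base change. -/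
noncomputable def adicCompletionToCompletedBaseChange :
    AdicCompletion m' (R' ⊗[R] A) →ₗ[R'] completedBaseChange R R' m' A where
  toFun x := ⟨fun i => quotientEquivBaseChangePiece R R' m' A i (x.val (i + 1)), fun i => by
    induction x using AdicCompletion.induction_on with | _ b
    simp only [AdicCompletion.mk_apply_coe, Submodule.mkQ_apply]
    rw [baseChangeTrans_quotientEquiv_mk]
    congr 1
    exact (AdicCompletion.AdicCauchySequence.mk_eq_mk (Nat.le_succ (i + 1)) b)⟩
  map_add' x y := by
    ext i
    simp
  map_smul' r x := by
    ext i
    simp [AdicCompletion.val_smul_apply]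

theorem adicCompletionToCompletedBaseChange_bijective :
    Function.Bijective (adicCompletionToCompletedBaseChange R R' m' A) := by
  constructor
  · refine (injective_iff_map_eq_zero _).2 fun x hx => ?_
    have h (i : ℕ) : x.val (i + 1) = 0 :=
      (quotientEquivBaseChangePiece R R' m' A i).map_eq_zero_iff.1
        (congrFun (congrArg Subtype.val hx) i)
    ext n
    rw [← x.prop (Nat.le_succ n), h]
    simp
  · intro f
    choose b hb using fun i => Submodule.Quotient.mk_surjective _
      ((quotientEquivBaseChangePiece R R' m' A i).symm (f.1 i))
    have hb' (i : ℕ) : quotientEquivBaseChangePiece R R' m' A i (Submodule.Quotient.mk (b i)) =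
        f.1 i := by rw [hb, LinearEquiv.apply_symm_apply]
    have hstep (i : ℕ) : b i ≡ b (i + 1) [SMOD (m' ^ (i + 1) • ⊤ : Submodule R' (R' ⊗[R] A))] := by
      apply (quotientEquivBaseChangePiece R R' m' A i).injective
      rw [hb', ← baseChangeTrans_quotientEquiv_mk, hb']
      exact (f.2 i).symm
    refine ⟨AdicCompletion.mk m' _ (AdicCompletion.AdicCauchySequence.mk m' _ b fun i =>
      (hstep i).mono (Submodule.smul_mono_left (Ideal.pow_le_pow_right (Nat.le_succ i)))), ?_⟩
    ext i
    rw [← hb' i]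
    exact congrArg (quotientEquivBaseChangePiece R R' m' A i) (hstep i).symm

/-- The completed base change is the `𝔪'`-adic completion of `R' ⊗_R A`. -/
noncomputable def adicCompletionEquivCompletedBaseChange :
    AdicCompletion m' (R' ⊗[R] A) ≃ₗ[R'] completedBaseChange R R' m' A :=
  LinearEquiv.ofBijective _ (adicCompletionToCompletedBaseChange_bijective R R' m' A)

theorem flat_completedBaseChange [IsNoetherianRing R'] [Module.Flat R A] :
    Module.Flat R' (completedBaseChange R R' m' A) :=
  have := AdicCompletion.flat_of_flat m' (R' ⊗[R] A)
  Module.Flat.of_linearEquiv (adicCompletionEquivCompletedBaseChange R R' m' A).symm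

theorem isAdicComplete_completedBaseChange (h : m'.FG) :
    IsAdicComplete m' (completedBaseChange R R' m' A) :=
  have := AdicCompletion.isAdicComplete (M := R' ⊗[R] A) h
  .of_linearEquiv m' (adicCompletionEquivCompletedBaseChange R R' m' A)

theorem mem_smul_top_completedBaseChange_iff (h : m'.FG) (x : completedBaseChange R R' m' A) :
    x ∈ (m' • ⊤ : Submodule R' (completedBaseChange R R' m' A)) ↔ x.1 0 = 0 := by
  obtain ⟨y, rfl⟩ := (adicCompletionEquivCompletedBaseChange R R' m' A).surjective x
  have hy : ((adicCompletionEquivCompletedBaseChange R R' m' A) y).1 0 =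
    quotientEquivBaseChangePiece R R' m' A 0 (y.val (0 + 1)) := rfl
  have h1 : (m' • ⊤ : Submodule R' (AdicCompletion m' (R' ⊗[R] A))) =
      LinearMap.ker (AdicCompletion.eval m' (R' ⊗[R] A) (0 + 1)) := by
    rw [← AdicCompletion.pow_smul_top_eq_ker_eval h, zero_add, pow_one]
  have h2 := LinearEquiv.apply_mem_smul_top_iff
    (adicCompletionEquivCompletedBaseChange R R' m' A) m' y
  rw [h1, LinearMap.mem_ker, AdicCompletion.eval_apply] at h2
  rw [hy, LinearEquiv.map_eq_zero_iff]
  exact h2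

variable {R R' m' A} in
/-- The ring homomorphism `R'_0 ⊗_R A → C` induced by compatible homomorphisms on the factors. -/
theorem exists_ringHom_baseChangePiece_zero {C : Type*} [CommRing C] (θ : R' →+* C) (ψ : A →+* C)
    (hθ : ∀ r ∈ m', θ r = 0) (hθψ : ∀ r, θ (algebraMap R R' r) = ψ (algebraMap R A r)) :
    ∃ Φ : baseChangePiece R R' m' A 0 →+* C,
      ∀ r a, Φ (Ideal.Quotient.mk (m' ^ (0 + 1)) r ⊗ₜ[R] a) = θ r * ψ a := by
  let : Algebra R C := (ψ.comp (algebraMap R A)).toAlgebra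
  let f : (R' ⧸ m' ^ (0 + 1)) →ₐ[R] C :=
    { Ideal.Quotient.lift (m' ^ (0 + 1)) θ (by simpa using hθ) with
      commutes' := hθψ }
  let g : A →ₐ[R] C := { ψ with commutes' := fun _ => rfl }
  exact ⟨(Algebra.TensorProduct.lift f g fun _ _ => Commute.all _ _).toRingHom, fun r a =>
    Algebra.TensorProduct.lift_tmul f g _ _ _⟩

end BaseChange

section ResidueField

open IsLocalRing

variable (K : Type*) [Field K] {R : Type*} [CommRing R] [Algebra K R] [IsLocalRing R]

theorem exists_sub_algebraMap_mem_maximalIdeal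
    (h : Function.Surjective (algebraMap K (ResidueField R))) (r : R) :
    ∃ k : K, r - algebraMap K R k ∈ maximalIdeal R := by
  obtain ⟨k, hk⟩ := h (residue R r)
  refine ⟨k, ?_⟩
  rw [← residue_eq_zero_iff, map_sub, ← hk, sub_eq_zero, IsScalarTower.algebraMap_apply K R]
  rfl

theorem algebraMap_mem_maximalIdeal {R' : Type*} [CommRing R'] [Algebra K R'] [IsLocalRing R']
    (h : Function.Surjective (algebraMap K (ResidueField R'))) [Algebra R R']
    [IsScalarTower K R R'] {s : R} (hs : s ∈ maximalIdeal R) :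
    algebraMap R R' s ∈ maximalIdeal R' := by
  obtain ⟨k, hk⟩ := exists_sub_algebraMap_mem_maximalIdeal K h (algebraMap R R' s)
  rcases eq_or_ne k 0 with rfl | hk0
  · simpa using hk
  · rw [IsScalarTower.algebraMap_apply K R R', ← map_sub] at hk
    have hu : IsUnit (s - algebraMap K R k) := by
      by_contra hn
      have := sub_mem hs ((mem_maximalIdeal _).2 hn)
      rw [sub_sub_cancel] at this
      exact (mem_maximalIdeal _).1 this ((IsUnit.mk0 k hk0).map _)
    exact absurd (hu.map (algebraMap R R')) hk

theorem exists_ringHom_of_bijective_algebraMap_residueField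
    (h : Function.Bijective (algebraMap K (ResidueField R)))
    (C : Type*) [CommRing C] [Algebra K C] :
    ∃ θ : R →+* C, (∀ k, θ (algebraMap K R k) = algebraMap K C k) ∧
      ∀ r ∈ maximalIdeal R, θ r = 0 := by
  refine ⟨((algebraMap K C).comp (RingEquiv.ofBijective _ h).symm.toRingHom).comp (residue R),
    fun k => ?_, fun r hr => ?_⟩
  · exact congrArg (algebraMap K C) ((RingEquiv.ofBijective _ h).symm_apply_apply k)
  · simp [(residue_eq_zero_iff r).2 hr]

end ResidueField

/-- Let `K` be a field, `(R, 𝔪)` and `(R', 𝔪')` parameter `K`-algebras,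
`σ : R → R'` a `K`-algebra homomorphism (encoded by `[Algebra R R']` compatible with the
`K`-structures), `C` a commutative `K`-algebra and `A` an associative `R`-deformation of
`C`, with surjective `K`-algebra augmentation `ψ : A → C` whose kernel is `𝔪A`.  Let
`A' := lim_i (R'_i ⊗_R A)`.  Then `A'`, with the componentwise induced multiplication,
is an associative `R'`-deformation of `C`: it is flat over `R'` and `𝔪'`-adically
complete, and it carries an augmentation `ψ' : A' → C` with kernel `𝔪'A'`; moreover the
canonical map `A → A'` is an `R`-algebra homomorphism compatible with the augmentations
to `C`. -/
theorem stmt_7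
    (K : Type u) [Field K]
    (R : Type u) [CommRing R] [Algebra K R] [IsLocalRing R] [IsNoetherianRing R]
    (hres : Function.Bijective (algebraMap K (IsLocalRing.ResidueField R)))
    [IsAdicComplete (IsLocalRing.maximalIdeal R) R]
    (R' : Type u) [CommRing R'] [Algebra K R'] [IsLocalRing R'] [IsNoetherianRing R']
    (hres' : Function.Bijective (algebraMap K (IsLocalRing.ResidueField R')))
    [IsAdicComplete (IsLocalRing.maximalIdeal R') R']
    [Algebra R R'] [IsScalarTower K R R']
    (C : Type u) [CommRing C] [Algebra K C]
    (A : Type u) [Ring A] [Algebra R A] [Algebra K A] [IsScalarTower K R A]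
    [Module.Flat R A] [IsAdicComplete (IsLocalRing.maximalIdeal R) A]
    (ψ : A →ₐ[K] C) (hψsurj : Function.Surjective ψ)
    (hψker : ∀ x : A, ψ x = 0 ↔ x ∈ (IsLocalRing.maximalIdeal R) • (⊤ : Submodule R A)) :
    -- `A'` is flat over `R'` and `𝔪'`-adically complete
    Module.Flat R'
      (completedBaseChange R R' (IsLocalRing.maximalIdeal R') A) ∧
    IsAdicComplete (IsLocalRing.maximalIdeal R')
      (completedBaseChange R R' (IsLocalRing.maximalIdeal R') A) ∧
    -- the canonical map `A → A'` is a (unital) `R`-algebra homomorphism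
    (canonicalBaseChange R R' (IsLocalRing.maximalIdeal R') A 1 = 1) ∧
    (∀ x y : A, canonicalBaseChange R R' (IsLocalRing.maximalIdeal R') A (x + y) =
      canonicalBaseChange R R' (IsLocalRing.maximalIdeal R') A x +
        canonicalBaseChange R R' (IsLocalRing.maximalIdeal R') A y) ∧
    (∀ x y : A, canonicalBaseChange R R' (IsLocalRing.maximalIdeal R') A (x * y) =
      canonicalBaseChange R R' (IsLocalRing.maximalIdeal R') A x *
        canonicalBaseChange R R' (IsLocalRing.maximalIdeal R') A y) ∧
    (∀ (r : R) (x : A), canonicalBaseChange R R' (IsLocalRing.maximalIdeal R') A (r • x) =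
      algebraMap R R' r • canonicalBaseChange R R' (IsLocalRing.maximalIdeal R') A x) ∧
    -- `A'` carries an augmentation to `C` compatible with that of `A`
    ∃ ψ' : (completedBaseChange R R' (IsLocalRing.maximalIdeal R') A) →+* C,
      (∀ (k : K) (x : completedBaseChange R R' (IsLocalRing.maximalIdeal R') A),
        ψ' (algebraMap K R' k • x) = algebraMap K C k * ψ' x) ∧
      Function.Surjective ψ' ∧
      (∀ x : completedBaseChange R R' (IsLocalRing.maximalIdeal R') A,
        ψ' x = 0 ↔ x ∈ (IsLocalRing.maximalIdeal R') •
          (⊤ : Submodule R' (completedBaseChange R R' (IsLocalRing.maximalIdeal R') A))) ∧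
      (∀ x : A, ψ' (canonicalBaseChange R R' (IsLocalRing.maximalIdeal R') A x) = ψ x) := by
  have hfg := IsNoetherian.noetherian (IsLocalRing.maximalIdeal R')
  refine ⟨flat_completedBaseChange R R' _ A, isAdicComplete_completedBaseChange R R' _ A hfg,
    rfl, fun x y => ?_, fun x y => ?_, fun r x => ?_, ?_⟩
  · ext i
    exact TensorProduct.tmul_add _ _ _
  · ext i
    exact ((Algebra.TensorProduct.tmul_mul_tmul 1 1 x y).trans (by rw [one_mul]; rfl)).symm
  · ext i
    exact (TensorProduct.tmul_smul r 1 x).trans (algebraMap_smul R' r _).symm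
  obtain ⟨θ, hθK, hθ⟩ := exists_ringHom_of_bijective_algebraMap_residueField K hres' C
  have hψ0 {s : R} (hs : s ∈ IsLocalRing.maximalIdeal R) (a : A) : ψ (s • a) = 0 :=
    (hψker _).2 (Submodule.smul_mem_smul hs Submodule.mem_top)
  have hθψ (r : R) : θ (algebraMap R R' r) = ψ (algebraMap R A r) := by
    obtain ⟨k, hk⟩ := exists_sub_algebraMap_mem_maximalIdeal K hres.2 r
    have h1 := hθ _ (algebraMap_mem_maximalIdeal K hres'.2 hk)
    have h2 := hψ0 hk 1
    rw [← Algebra.algebraMap_eq_smul_one, map_sub, map_sub,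
      ← IsScalarTower.algebraMap_apply, AlgHom.commutes, sub_eq_zero] at h2
    rw [map_sub, map_sub, ← IsScalarTower.algebraMap_apply, hθK, sub_eq_zero] at h1
    rw [h1, h2]
  obtain ⟨Φ, hΦ⟩ := exists_ringHom_baseChangePiece_zero θ (ψ : A →+* C) hθ hθψ
  have hΦ1 (a : A) : Φ (1 ⊗ₜ[R] a) = ψ a := by simpa using hΦ 1 a
  have hone (x : baseChangePiece R R' (IsLocalRing.maximalIdeal R') A 0) :
      ∃ a : A, 1 ⊗ₜ[R] a = x := by
    induction x using TensorProduct.induction_on with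
    | zero => exact ⟨0, TensorProduct.tmul_zero _ _⟩
    | add x y hx hy =>
      obtain ⟨a, rfl⟩ := hx
      obtain ⟨b, rfl⟩ := hy
      exact ⟨a + b, TensorProduct.tmul_add _ _ _⟩
    | tmul r a =>
      obtain ⟨r, rfl⟩ := Ideal.Quotient.mk_surjective r
      obtain ⟨k, hk⟩ := exists_sub_algebraMap_mem_maximalIdeal K hres'.2 r
      refine ⟨algebraMap K R k • a, ?_⟩
      rw [← TensorProduct.smul_tmul]
      congr 1
      rw [← Algebra.algebraMap_eq_smul_one, IsScalarTower.algebraMap_apply R R',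
        ← IsScalarTower.algebraMap_apply K R R', Ideal.Quotient.algebraMap_eq, eq_comm,
        Ideal.Quotient.eq]
      simpa using hk
  have hker (x : baseChangePiece R R' (IsLocalRing.maximalIdeal R') A 0) (hx : Φ x = 0) :
      x = 0 := by
    obtain ⟨a, rfl⟩ := hone x
    rw [hΦ1, hψker] at hx
    refine Submodule.smul_induction_on hx (fun s hs a _ => ?_) fun a b ha hb => ?_
    · rw [← TensorProduct.smul_tmul, ← Algebra.algebraMap_eq_smul_one,
        IsScalarTower.algebraMap_apply R R', Ideal.Quotient.algebraMap_eq,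
        Ideal.Quotient.eq_zero_iff_mem.2, TensorProduct.zero_tmul]
      simpa using algebraMap_mem_maximalIdeal K hres'.2 hs
    · rw [TensorProduct.tmul_add, ha, hb, add_zero]
  refine ⟨Φ.comp ((Pi.evalRingHom _ 0).comp
    (completedBaseChange R R' (IsLocalRing.maximalIdeal R') A).val.toRingHom),
    fun k x => ?_, fun c => ?_, fun x => ?_, fun x => hΦ1 x⟩
  · rw [Algebra.smul_def, map_mul]
    congr 1
    refine (hΦ (algebraMap K R' k) 1).trans ?_
    simp [hθK]
  · obtain ⟨a, rfl⟩ := hψsurj c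
    exact ⟨canonicalBaseChange R R' _ A a, hΦ1 a⟩
  · rw [mem_smul_top_completedBaseChange_iff R R' _ A hfg]
    exact ⟨hker _, fun h => (congrArg Φ h).trans (map_zero Φ)⟩
end
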